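/- Let A be a commutative ring and B a commutative A-algebra which is free of finite rank as an A-module. Let I₁ and I₂ be ideals of B such that the quotient rings B/I₁ and B/I₂ are also free of finite rank as A-modules. Then there exists an ideal J of A with the following universal property: for every commutative A-algebra A′, the extension of I₂ to A′ ⊗[A] B is contained in the extension of I₁ to A′ ⊗[A] B if and only if the extension of J to A′ is the zero ideal (equivalently, if and only if the structure homomorphism A → A′ factors through the quotient A/J). -/

import Mathlib

open TensorProduct

/-- An element `1 ⊗ x` lies in the extension of `I` to `A' ⊗[A] B` if and only if the coordinates
of `x` in an `A`-basis of `B ⧸ I` vanish in `A'`. -/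
theorem includeRight_mem_map_iff_repr_mem_ker {A B ι : Type*} [CommRing A] [CommRing B]
    [Algebra A B] (I : Ideal B) (b : Module.Basis ι A (B ⧸ I)) (A' : Type*) [CommRing A']
    [Algebra A A'] (x : B) :
    (Algebra.TensorProduct.includeRight : B →ₐ[A] A' ⊗[A] B) x ∈
        I.map (Algebra.TensorProduct.includeRight : B →ₐ[A] A' ⊗[A] B) ↔
      ∀ i, b.repr (Ideal.Quotient.mk I x) i ∈ RingHom.ker (algebraMap A A') := by
  have hker := Algebra.TensorProduct.lTensor_ker (A := A') (Ideal.Quotient.mkₐ A I)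
    (Ideal.Quotient.mkₐ_surjective A I)
  rw [show RingHom.ker (Ideal.Quotient.mkₐ A I) = I from Ideal.Quotient.mkₐ_ker A I] at hker
  rw [← hker, RingHom.mem_ker, Algebra.TensorProduct.includeRight_apply,
    Algebra.TensorProduct.map_tmul, map_one, ← (b.baseChange A').repr.map_eq_zero_iff,
    Finsupp.ext_iff]
  refine forall_congr' fun i => ?_
  rw [Module.Basis.baseChange_repr_tmul, RingHom.mem_ker, Algebra.algebraMap_eq_smul_one]
  rfl

/-- The structure map `A → A'` factors through `A ⧸ J` if and only if `J` extends to zero. -/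
theorem Ideal.map_eq_bot_iff_exists_comp_mk {A A' : Type*} [CommRing A] [CommRing A']
    (f : A →+* A') (J : Ideal A) :
    J.map f = ⊥ ↔ ∃ g : A ⧸ J →+* A', g.comp (Ideal.Quotient.mk J) = f := by
  rw [Ideal.map_eq_bot_iff_le_ker]
  constructor
  · exact fun h => ⟨Ideal.Quotient.lift J f h, Ideal.Quotient.lift_comp_mk J f h⟩
  · rintro ⟨g, rfl⟩ a ha
    rw [RingHom.mem_ker, RingHom.comp_apply, Ideal.Quotient.eq_zero_iff_mem.mpr ha, map_zero]


/-- Let `A` be a commutative ring and `B` a commutative `A`-algebra which is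
free of finite rank as an `A`-module.  Let `I₁`, `I₂` be ideals of `B` such that `B ⧸ I₁` and
`B ⧸ I₂` are also free of finite rank as `A`-modules.  Then there is an ideal `J` of `A` such
that for every commutative `A`-algebra `A'`, the extension of `I₂` to `A' ⊗[A] B` is contained
in the extension of `I₁` to `A' ⊗[A] B` if and only if the extension of `J` to `A'` is the zero
ideal, equivalently if and only if `A → A'` factors through `A ⧸ J`. -/
theorem stmt0 {A B : Type*} [CommRing A] [CommRing B] [Algebra A B]
    [Module.Free A B] [Module.Finite A B]
    (I₁ I₂ : Ideal B)
    [Module.Free A (B ⧸ I₁)] [Module.Finite A (B ⧸ I₁)]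
    [Module.Free A (B ⧸ I₂)] [Module.Finite A (B ⧸ I₂)] :
    ∃ J : Ideal A, ∀ (A' : Type*) [CommRing A'] [Algebra A A'],
      ((I₂.map (Algebra.TensorProduct.includeRight : B →ₐ[A] A' ⊗[A] B) ≤
          I₁.map (Algebra.TensorProduct.includeRight : B →ₐ[A] A' ⊗[A] B)) ↔
        J.map (algebraMap A A') = ⊥) ∧
      ((I₂.map (Algebra.TensorProduct.includeRight : B →ₐ[A] A' ⊗[A] B) ≤
          I₁.map (Algebra.TensorProduct.includeRight : B →ₐ[A] A' ⊗[A] B)) ↔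
        ∃ g : A ⧸ J →+* A', g.comp (Ideal.Quotient.mk J) = algebraMap A A') := by
  let b := Module.Free.chooseBasis A (B ⧸ I₁)
  refine ⟨Ideal.span {a | ∃ x ∈ I₂, ∃ i, b.repr (Ideal.Quotient.mk I₁ x) i = a},
    fun A' _ _ => ?_⟩
  rw [← Ideal.map_eq_bot_iff_exists_comp_mk, and_self, Ideal.map_eq_bot_iff_le_ker,
    Ideal.span_le, Ideal.map_le_iff_le_comap]
  constructor
  · rintro h _ ⟨x, hx, i, rfl⟩
    exact (includeRight_mem_map_iff_repr_mem_ker I₁ b A' x).mp (h hx) i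
  · exact fun h x hx => (includeRight_mem_map_iff_repr_mem_ker I₁ b A' x).mpr
      fun i => h ⟨x, hx, i, rfl⟩
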